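/- For every p ∈ [1,∞] and any two finite metric measure spaces (X,d_X,μ_X) and (Y,d_Y,μ_Y), the p-edit distance in the category mm equals twice the p-Gromov–Wasserstein distance: d^{E,p}_mm(X,Y) = 2 · d_GW,p(X,Y). -/

import Mathlib

/-!
STATEMENT 2: For every `p ∈ [1,∞]` and any two finite metric measure spaces
`(X,d_X,μ_X)` and `(Y,d_Y,μ_Y)`, the `p`-edit distance in the category `mm` equals
twice the `p`-Gromov–Wasserstein distance: `d^{E,p}_mm(X,Y) = 2 · d_GW,p(X,Y)`.

Objects of `mm` are finite metric measure spaces (finite metric spaces with a fully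
supported probability measure); morphisms are order-preserving mm-space functions
(metric order-preserving Monge maps), with `p`-cost their `p`-distortion.  A path is a
finite zigzag of morphisms, its cost is the sum of costs, and the `p`-edit distance is
the infimum of costs of paths.  The `p`-Gromov–Wasserstein distance is half the
infimum over couplings of the `p`-distortion.
-/

open scoped ENNReal
open Classical

noncomputable section

/-- A finite metric measure space. -/
structure FMM where
  carrier : Type
  [fin : Fintype carrier]
  [ne : Nonempty carrier]
  d : carrier → carrier → ℝ
  nonneg : ∀ x y, 0 ≤ d x y
  symm : ∀ x y, d x y = d y x
  refl : ∀ x, d x x = 0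
  separated : ∀ x y, d x y = 0 → x = y
  triangle : ∀ x y z, d x z ≤ d x y + d y z
  w : carrier → ℝ
  w_pos : ∀ x, 0 < w x
  w_sum : ∑ x, w x = 1

attribute [instance] FMM.fin FMM.ne

/-- An order-preserving mm-space function: a metric order-preserving Monge map. -/
structure MMHom (X Y : FMM) where
  toFun : X.carrier → Y.carrier
  ordPres : ∀ a b c e : X.carrier,
    X.d c e ≤ X.d a b → Y.d (toFun c) (toFun e) ≤ Y.d (toFun a) (toFun b)
  monge : ∀ y : Y.carrier, ∑ x, (if toFun x = y then X.w x else 0) = Y.w y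

/-- The `p`-cost (`p`-distortion) of an order-preserving mm-space function. -/
def MMHom.pcost {X Y : FMM} (f : MMHom X Y) (p : ℝ≥0∞) : ℝ :=
  if p = ⊤ then
    ⨆ x : X.carrier, ⨆ x' : X.carrier, |X.d x x' - Y.d (f.toFun x) (f.toFun x')|
  else
    (∑ x, ∑ x', |X.d x x' - Y.d (f.toFun x) (f.toFun x')| ^ p.toReal
       * X.w x * X.w x') ^ (1 / p.toReal)

/-- A zigzag path of order-preserving mm-space functions. -/
inductive MMPath : FMM → FMM → Type 1
  | nil (X : FMM) : MMPath X X
  | fwd {X Y Z : FMM} (f : MMHom X Y) (p : MMPath Y Z) : MMPath X Z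
  | bwd {X Y Z : FMM} (f : MMHom Y X) (p : MMPath Y Z) : MMPath X Z

/-- The `p`-cost of a path: the sum of the `p`-costs of its morphisms. -/
def mmPathCost (p : ℝ≥0∞) : ∀ {X Y : FMM}, MMPath X Y → ℝ
  | _, _, .nil _ => 0
  | _, _, .fwd f q => f.pcost p + mmPathCost p q
  | _, _, .bwd f q => f.pcost p + mmPathCost p q

/-- The `p`-edit distance between finite metric measure spaces. -/
def editDistMM (p : ℝ≥0∞) (X Y : FMM) : ℝ≥0∞ :=
  ⨅ q : MMPath X Y, ENNReal.ofReal (mmPathCost p q)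

/-- A coupling between the measures of two finite metric measure spaces. -/
structure Coupling (X Y : FMM) where
  π : X.carrier → Y.carrier → ℝ
  nonneg : ∀ x y, 0 ≤ π x y
  margX : ∀ x, ∑ y, π x y = X.w x
  margY : ∀ y, ∑ x, π x y = Y.w y

/-- The `p`-distortion of a coupling. -/
def Coupling.disP {X Y : FMM} (c : Coupling X Y) (p : ℝ≥0∞) : ℝ :=
  if p = ⊤ then
    sSup {v | ∃ x y x' y', 0 < c.π x y ∧ 0 < c.π x' y' ∧ v = |X.d x x' - Y.d y y'|}
  else
    (∑ x, ∑ y, ∑ x', ∑ y', |X.d x x' - Y.d y y'| ^ p.toReal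
       * c.π x y * c.π x' y') ^ (1 / p.toReal)

/-- The `p`-Gromov–Wasserstein distance between finite metric measure spaces. -/
def dGW (p : ℝ≥0∞) (X Y : FMM) : ℝ≥0∞ :=
  (1 / 2) * ⨅ c : Coupling X Y, ENNReal.ofReal (c.disP p)

/-- The `p`-seminorm of a kernel `δ` with respect to the product of a finite measure `m` with
itself. -/
def kernelNorm {I : Type*} [Fintype I] (p : ℝ≥0∞) (m : I → ℝ) (δ : I → I → ℝ) : ℝ :=
  if p = ⊤ then sSup {v | ∃ i j, 0 < m i ∧ 0 < m j ∧ v = |δ i j|}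
  else (∑ i, ∑ j, |δ i j| ^ p.toReal * m i * m j) ^ (1 / p.toReal)

/-- The weight `n` is the pushforward of the weight `m` along `g`. -/
def IsPushforward {I J : Type*} [Fintype I] [Fintype J] (g : I → J) (m : I → ℝ) (n : J → ℝ) :
    Prop :=
  ∀ F : J → ℝ, ∑ j, F j * n j = ∑ i, F (g i) * m i

section KernelNorm

variable {I J : Type*} [Fintype I] [Fintype J] {p : ℝ≥0∞}

theorem bddAbove_kernelNorm_set (m : I → ℝ) (δ : I → I → ℝ) :
    BddAbove {v | ∃ i j, 0 < m i ∧ 0 < m j ∧ v = |δ i j|} := by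
  refine ((Set.finite_range fun q : I × I => |δ q.1 q.2|).subset ?_).bddAbove
  rintro v ⟨i, j, -, -, rfl⟩
  exact ⟨(i, j), rfl⟩

theorem kernelNorm_nonneg {m : I → ℝ} (hm : ∀ i, 0 ≤ m i) (δ : I → I → ℝ) :
    0 ≤ kernelNorm p m δ := by
  unfold kernelNorm
  split_ifs
  · refine Real.sSup_nonneg ?_
    rintro v ⟨i, j, -, -, rfl⟩
    exact abs_nonneg _
  · exact Real.rpow_nonneg (Finset.sum_nonneg fun i _ => Finset.sum_nonneg fun j _ =>
      mul_nonneg (mul_nonneg (Real.rpow_nonneg (abs_nonneg _) _) (hm i)) (hm j)) _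

theorem kernelNorm_neg (m : I → ℝ) (δ : I → I → ℝ) :
    kernelNorm p m (fun i j => -δ i j) = kernelNorm p m δ := by
  simp only [kernelNorm, abs_neg]

theorem IsPushforward.pos_iff {g : I → J} {m : I → ℝ} {n : J → ℝ}
    (h : IsPushforward g m n) (hm : ∀ i, 0 ≤ m i) (j : J) :
    0 < n j ↔ ∃ i, g i = j ∧ 0 < m i := by
  have hj : n j = ∑ i, if g i = j then m i else 0 := by
    simpa using h fun k => if k = j then 1 else 0
  have hnonneg : ∀ i ∈ Finset.univ, 0 ≤ if g i = j then m i else 0 := fun i _ => by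
    split_ifs
    exacts [hm i, le_rfl]
  rw [hj, Finset.sum_pos_iff_of_nonneg hnonneg]
  refine exists_congr fun i => ?_
  by_cases hi : g i = j <;> simp [hi]

theorem IsPushforward.kernelNorm_eq {g : I → J} {m : I → ℝ} {n : J → ℝ}
    (h : IsPushforward g m n) (hm : ∀ i, 0 ≤ m i) (δ : J → J → ℝ) :
    kernelNorm p n δ = kernelNorm p m fun i i' => δ (g i) (g i') := by
  unfold kernelNorm
  split_ifs
  · congr 1
    ext v
    simp only [Set.mem_ofPred_eq, h.pos_iff hm]
    constructor
    · rintro ⟨_, _, ⟨i, rfl, hi⟩, ⟨i', rfl, hi'⟩, rfl⟩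
      exact ⟨i, i', hi, hi', rfl⟩
    · rintro ⟨i, i', hi, hi', rfl⟩
      exact ⟨_, _, ⟨i, rfl, hi⟩, ⟨i', rfl, hi'⟩, rfl⟩
  · congr 1
    have hinner : ∀ j, ∑ j', |δ j j'| ^ p.toReal * n j * n j' =
        (∑ i', |δ j (g i')| ^ p.toReal * m i') * n j := fun j => by
      rw [← h fun j' => |δ j j'| ^ p.toReal, Finset.sum_mul]
      exact Finset.sum_congr rfl fun _ _ => by ring
    simp only [hinner]
    rw [h fun j => ∑ i', |δ j (g i')| ^ p.toReal * m i']
    refine Finset.sum_congr rfl fun i _ => ?_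
    rw [Finset.sum_mul]
    exact Finset.sum_congr rfl fun _ _ => by ring

theorem one_le_toReal_of_one_le (hp : 1 ≤ p) (h : p ≠ ⊤) : 1 ≤ p.toReal := by
  simpa using ENNReal.toReal_mono h hp

theorem kernelNorm_const_mul_le (hp : 1 ≤ p) {m : I → ℝ} (hm : ∀ i, 0 ≤ m i) (r : ℝ)
    (δ : I → I → ℝ) :
    kernelNorm p m (fun i j => r * δ i j) ≤ |r| * kernelNorm p m δ := by
  have hnonneg := mul_nonneg (abs_nonneg r) (kernelNorm_nonneg (p := p) hm δ)
  unfold kernelNorm at *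
  split_ifs at * with h
  · refine Real.sSup_le ?_ hnonneg
    rintro v ⟨i, j, hi, hj, rfl⟩
    rw [abs_mul]
    exact mul_le_mul_of_nonneg_left
      (le_csSup (bddAbove_kernelNorm_set m δ) ⟨i, j, hi, hj, rfl⟩) (abs_nonneg r)
  · have hp0 : p.toReal ≠ 0 := by linarith [one_le_toReal_of_one_le hp h]
    have hsum : 0 ≤ ∑ i, ∑ j, |δ i j| ^ p.toReal * m i * m j :=
      Finset.sum_nonneg fun i _ => Finset.sum_nonneg fun j _ =>
        mul_nonneg (mul_nonneg (Real.rpow_nonneg (abs_nonneg _) _) (hm i)) (hm j)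
    have hscale : ∑ i, ∑ j, |r * δ i j| ^ p.toReal * m i * m j =
        |r| ^ p.toReal * ∑ i, ∑ j, |δ i j| ^ p.toReal * m i * m j := by
      simp only [Finset.mul_sum]
      refine Finset.sum_congr rfl fun i _ => Finset.sum_congr rfl fun j _ => ?_
      rw [abs_mul, Real.mul_rpow (abs_nonneg _) (abs_nonneg _)]
      ring
    rw [hscale, Real.mul_rpow (Real.rpow_nonneg (abs_nonneg _) _) hsum,
      ← Real.rpow_mul (abs_nonneg _), mul_one_div_cancel hp0, Real.rpow_one]

theorem kernelNorm_add_le (hp : 1 ≤ p) {m : I → ℝ} (hm : ∀ i, 0 ≤ m i) (δ η : I → I → ℝ) :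
    kernelNorm p m (fun i j => δ i j + η i j) ≤ kernelNorm p m δ + kernelNorm p m η := by
  have hnonneg := add_nonneg (kernelNorm_nonneg (p := p) hm δ) (kernelNorm_nonneg (p := p) hm η)
  unfold kernelNorm at *
  split_ifs at * with h
  · refine Real.sSup_le ?_ hnonneg
    rintro v ⟨i, j, hi, hj, rfl⟩
    exact (abs_add_le _ _).trans (add_le_add
      (le_csSup (bddAbove_kernelNorm_set m δ) ⟨i, j, hi, hj, rfl⟩)
      (le_csSup (bddAbove_kernelNorm_set m η) ⟨i, j, hi, hj, rfl⟩))
  · have hp1 := one_le_toReal_of_one_le hp h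
    have hp0 : p.toReal ≠ 0 := by linarith
    have hsum : ∀ κ : I → I → ℝ, ∑ i, ∑ j, |κ i j| ^ p.toReal * m i * m j =
        ∑ q : I × I, |κ q.1 q.2 * (m q.1 * m q.2) ^ (1 / p.toReal)| ^ p.toReal := fun κ => by
      rw [Fintype.sum_prod_type]
      refine Finset.sum_congr rfl fun i _ => Finset.sum_congr rfl fun j _ => ?_
      have hij := mul_nonneg (hm i) (hm j)
      rw [abs_mul, abs_of_nonneg (Real.rpow_nonneg hij _),
        Real.mul_rpow (abs_nonneg _) (Real.rpow_nonneg hij _), ← Real.rpow_mul hij,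
        one_div_mul_cancel hp0, Real.rpow_one, mul_assoc]
    simp only [hsum, add_mul]
    exact Real.Lp_add_le _ _ _ hp1

end KernelNorm

section CostsAsKernelNorms

variable {X Y : FMM} {p : ℝ≥0∞}

theorem MMHom.pcost_eq_kernelNorm (f : MMHom X Y) :
    f.pcost p = kernelNorm p X.w fun x x' => X.d x x' - Y.d (f.toFun x) (f.toFun x') := by
  unfold MMHom.pcost kernelNorm
  split_ifs
  · have hbdd := bddAbove_kernelNorm_set X.w
      fun x x' => X.d x x' - Y.d (f.toFun x) (f.toFun x')
    refine le_antisymm (ciSup_le fun x => ciSup_le fun x' =>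
      le_csSup hbdd ⟨x, x', X.w_pos x, X.w_pos x', rfl⟩) ?_
    refine Real.sSup_le ?_ (Real.iSup_nonneg fun x => Real.iSup_nonneg fun x' => abs_nonneg _)
    rintro v ⟨x, x', -, -, rfl⟩
    exact (le_ciSup (f := fun x' => |X.d x x' - Y.d (f.toFun x) (f.toFun x')|)
      (Set.finite_range _).bddAbove x').trans
      (le_ciSup (f := fun x => ⨆ x', |X.d x x' - Y.d (f.toFun x) (f.toFun x')|)
        (Set.finite_range _).bddAbove x)
  · rfl

/-- The difference of the two metrics on `X × Y`. -/
def metricDiff (X Y : FMM) (q q' : X.carrier × Y.carrier) : ℝ :=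
  X.d q.1 q'.1 - Y.d q.2 q'.2

/-- The weight on `X × Y` of a coupling. -/
def Coupling.weight (c : Coupling X Y) (q : X.carrier × Y.carrier) : ℝ :=
  c.π q.1 q.2

theorem Coupling.weight_nonneg (c : Coupling X Y) (q : X.carrier × Y.carrier) :
    0 ≤ c.weight q :=
  c.nonneg _ _

theorem Coupling.disP_eq_kernelNorm (c : Coupling X Y) :
    c.disP p = kernelNorm p c.weight (metricDiff X Y) := by
  unfold Coupling.disP kernelNorm metricDiff Coupling.weight
  split_ifs
  · congr 1
    ext v
    simp only [Set.mem_ofPred_eq, Prod.exists]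
  · simp only [Fintype.sum_prod_type]

/-- The coupling carried by the graph of a morphism. -/
def MMHom.graph (f : MMHom X Y) : Coupling X Y where
  π x y := if f.toFun x = y then X.w x else 0
  nonneg x y := by
    split_ifs
    exacts [(X.w_pos x).le, le_rfl]
  margX x := by simp
  margY := f.monge

/-- A coupling with its two sides exchanged. -/
def Coupling.swap (c : Coupling X Y) : Coupling Y X where
  π y x := c.π x y
  nonneg y x := c.nonneg x y
  margX := c.margY
  margY := c.margX

theorem MMHom.disP_graph (f : MMHom X Y) : f.graph.disP p = f.pcost p := by
  have h : IsPushforward (fun x => (x, f.toFun x)) X.w f.graph.weight := fun F => by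
    simp [Fintype.sum_prod_type, Coupling.weight, MMHom.graph]
  rw [Coupling.disP_eq_kernelNorm, MMHom.pcost_eq_kernelNorm,
    h.kernelNorm_eq fun x => (X.w_pos x).le]
  rfl

theorem Coupling.disP_swap (c : Coupling X Y) : c.swap.disP p = c.disP p := by
  have h : IsPushforward Prod.swap c.weight c.swap.weight := fun F => by
    simp only [Fintype.sum_prod_type]
    exact Finset.sum_comm
  rw [Coupling.disP_eq_kernelNorm, Coupling.disP_eq_kernelNorm,
    h.kernelNorm_eq c.weight_nonneg, ← kernelNorm_neg]
  congr 1
  funext q q'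
  simp [metricDiff]

end CostsAsKernelNorms

section Gluing

variable {X Y Z : FMM} {p : ℝ≥0∞}

/-- The weight on `X × Y × Z` gluing two couplings along `Y`. -/
def Coupling.glueWeight (c : Coupling X Y) (c' : Coupling Y Z)
    (q : X.carrier × Y.carrier × Z.carrier) : ℝ :=
  c.π q.1 q.2.1 * c'.π q.2.1 q.2.2 / Y.w q.2.1

theorem Coupling.glueWeight_nonneg (c : Coupling X Y) (c' : Coupling Y Z)
    (q : X.carrier × Y.carrier × Z.carrier) : 0 ≤ c.glueWeight c' q :=
  div_nonneg (mul_nonneg (c.nonneg _ _) (c'.nonneg _ _)) (Y.w_pos _).le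

theorem Coupling.sum_glueWeight_right (c : Coupling X Y) (c' : Coupling Y Z)
    (x : X.carrier) (y : Y.carrier) : ∑ z, c.glueWeight c' (x, y, z) = c.π x y := by
  simp only [Coupling.glueWeight]
  rw [← Finset.sum_div, ← Finset.mul_sum, c'.margX, mul_div_cancel_right₀ _ (Y.w_pos y).ne']

theorem Coupling.sum_glueWeight_left (c : Coupling X Y) (c' : Coupling Y Z)
    (y : Y.carrier) (z : Z.carrier) : ∑ x, c.glueWeight c' (x, y, z) = c'.π y z := by
  simp only [Coupling.glueWeight]
  rw [← Finset.sum_div, ← Finset.sum_mul, c.margY, mul_div_cancel_left₀ _ (Y.w_pos y).ne']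

/-- The composition of two couplings. -/
def Coupling.comp (c : Coupling X Y) (c' : Coupling Y Z) : Coupling X Z where
  π x z := ∑ y, c.glueWeight c' (x, y, z)
  nonneg x z := Finset.sum_nonneg fun y _ => c.glueWeight_nonneg c' _
  margX x := by
    rw [Finset.sum_comm]
    simp only [c.sum_glueWeight_right c', c.margX]
  margY z := by
    rw [Finset.sum_comm]
    simp only [c.sum_glueWeight_left c', c'.margY]

theorem Coupling.disP_comp_le (hp : 1 ≤ p) (c : Coupling X Y) (c' : Coupling Y Z) :
    (c.comp c').disP p ≤ c.disP p + c'.disP p := by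
  have h₁ : IsPushforward (fun q => (q.1, q.2.1)) (c.glueWeight c') c.weight := fun F => by
    simp only [Fintype.sum_prod_type, ← Finset.mul_sum, c.sum_glueWeight_right c']
    rfl
  have h₂ : IsPushforward (fun q => q.2) (c.glueWeight c') c'.weight := fun F => by
    refine Eq.trans ?_ (Fintype.sum_prod_type_right _).symm
    simp only [← Finset.mul_sum]
    exact Finset.sum_congr rfl fun q _ => by
      rw [c.sum_glueWeight_left c' q.1 q.2, Coupling.weight]
  have h₃ : IsPushforward (fun q => (q.1, q.2.2)) (c.glueWeight c') (c.comp c').weight :=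
    fun F => by
      simp only [Fintype.sum_prod_type, Coupling.weight, Coupling.comp, Finset.mul_sum]
      exact Finset.sum_congr rfl fun x _ => Finset.sum_comm
  have hm := c.glueWeight_nonneg c'
  rw [Coupling.disP_eq_kernelNorm, Coupling.disP_eq_kernelNorm, Coupling.disP_eq_kernelNorm,
    h₁.kernelNorm_eq hm, h₂.kernelNorm_eq hm, h₃.kernelNorm_eq hm]
  convert kernelNorm_add_le hp hm _ _ using 2
  funext q q'
  simp only [metricDiff]
  ring

end Gluing

section Paths

variable {X Y Z : FMM} {p : ℝ≥0∞}

/-- The identity morphism. -/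
def MMHom.id (X : FMM) : MMHom X X where
  toFun x := x
  ordPres _ _ _ _ h := h
  monge y := by simp

theorem MMHom.pcost_id (hp : 1 ≤ p) : (MMHom.id X).pcost p ≤ 0 := by
  rw [MMHom.pcost_eq_kernelNorm]
  simpa [MMHom.id] using
    kernelNorm_const_mul_le hp (fun x => (X.w_pos x).le) 0 (fun _ _ : X.carrier => 0)

theorem MMPath.exists_coupling (hp : 1 ≤ p) (q : MMPath X Y) :
    ∃ c : Coupling X Y, c.disP p ≤ mmPathCost p q := by
  induction q with
  | nil X => exact ⟨(MMHom.id X).graph, (MMHom.disP_graph _).trans_le (MMHom.pcost_id hp)⟩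
  | fwd f q ih =>
    obtain ⟨c, hc⟩ := ih
    refine ⟨f.graph.comp c, (Coupling.disP_comp_le hp _ _).trans ?_⟩
    rw [f.disP_graph]
    exact add_le_add le_rfl hc
  | bwd f q ih =>
    obtain ⟨c, hc⟩ := ih
    refine ⟨f.graph.swap.comp c, (Coupling.disP_comp_le hp _ _).trans ?_⟩
    rw [Coupling.disP_swap, f.disP_graph]
    exact add_le_add le_rfl hc

/-- Concatenation of paths. -/
def MMPath.append : ∀ {X Y Z : FMM}, MMPath X Y → MMPath Y Z → MMPath X Z
  | _, _, _, .nil _, r => r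
  | _, _, _, .fwd f q, r => .fwd f (q.append r)
  | _, _, _, .bwd f q, r => .bwd f (q.append r)

theorem mmPathCost_append (q : MMPath X Y) (r : MMPath Y Z) :
    mmPathCost p (q.append r) = mmPathCost p q + mmPathCost p r := by
  induction q with
  | nil X => simp [MMPath.append, mmPathCost]
  | fwd f q ih => simp [MMPath.append, mmPathCost, ih, add_assoc]
  | bwd f q ih => simp [MMPath.append, mmPathCost, ih, add_assoc]

end Paths

section Interpolation

variable {X Y : FMM} {p : ℝ≥0∞}

/-- The support of a coupling. -/
abbrev Coupling.Supp (c : Coupling X Y) : Type :=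
  {q : X.carrier × Y.carrier // 0 < c.weight q}

/-- The linear interpolation between the two metrics. -/
def Coupling.interpDist (c : Coupling X Y) (t : ℝ) (a b : c.Supp) : ℝ :=
  (1 - t) * X.d a.1.1 b.1.1 + t * Y.d a.1.2 b.1.2

theorem Coupling.isPushforward_supp (c : Coupling X Y) :
    IsPushforward (fun a : c.Supp => a.1) (fun a => c.weight a.1) c.weight := fun F => by
  rw [← Finset.sum_subtype (Finset.univ.filter fun q => 0 < c.weight q) (by simp)
    fun q => F q * c.weight q, Finset.sum_filter_of_ne]
  intro q _ hq
  exact (c.weight_nonneg q).lt_of_ne' (right_ne_zero_of_mul hq)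

theorem Coupling.sum_supp (c : Coupling X Y) : ∑ a : c.Supp, c.weight a.1 = 1 := by
  have h := c.isPushforward_supp fun _ => 1
  simp only [one_mul] at h
  rw [← h, Fintype.sum_prod_type]
  simp only [Coupling.weight, c.margX, X.w_sum]

theorem Coupling.nonempty_supp (c : Coupling X Y) : Nonempty c.Supp := by
  by_contra h
  rw [not_nonempty_iff] at h
  simpa using c.sum_supp

/-- The support of a coupling with the interpolated metric. -/
def Coupling.interp (c : Coupling X Y) (t : ℝ) (ht : t ∈ Set.Ioo (0 : ℝ) 1) : FMM :=
  have h0 : 0 < t := ht.1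
  have h1 : 0 < 1 - t := sub_pos.2 ht.2
  { carrier := c.Supp
    ne := c.nonempty_supp
    d := c.interpDist t
    nonneg := fun a b => add_nonneg (mul_nonneg h1.le (X.nonneg _ _))
      (mul_nonneg h0.le (Y.nonneg _ _))
    symm := fun a b => by
      simp only [Coupling.interpDist, X.symm a.1.1 b.1.1, Y.symm a.1.2 b.1.2]
    refl := fun a => by simp [Coupling.interpDist, X.refl, Y.refl]
    separated := fun a b h => by
      have hX := mul_nonneg h1.le (X.nonneg a.1.1 b.1.1)
      have hY := mul_nonneg h0.le (Y.nonneg a.1.2 b.1.2)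
      obtain ⟨hX', hY'⟩ := (add_eq_zero_iff_of_nonneg hX hY).1 h
      exact Subtype.ext (Prod.ext
        (X.separated _ _ ((mul_eq_zero.1 hX').resolve_left h1.ne'))
        (Y.separated _ _ ((mul_eq_zero.1 hY').resolve_left h0.ne')))
    triangle := fun a b e => by
      have hX := mul_le_mul_of_nonneg_left (X.triangle a.1.1 b.1.1 e.1.1) h1.le
      have hY := mul_le_mul_of_nonneg_left (Y.triangle a.1.2 b.1.2 e.1.2) h0.le
      simp only [Coupling.interpDist]
      linarith
    w := fun a => c.weight a.1
    w_pos := fun a => a.2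
    w_sum := c.sum_supp }

/-- `φ` exhibits `W` as the quotient, by points at distance zero, of the support of `c` with the
metric interpolated at `t`. -/
structure Coupling.Realizes (c : Coupling X Y) (t : ℝ) (W : FMM) (φ : c.Supp → W.carrier) :
    Prop where
  dist : ∀ a b, W.d (φ a) (φ b) = c.interpDist t a b
  mass : ∀ y, ∑ a, (if φ a = y then c.weight a.1 else 0) = W.w y

theorem Coupling.realizes_interp (c : Coupling X Y) {t : ℝ} (ht : t ∈ Set.Ioo (0 : ℝ) 1) :
    c.Realizes t (c.interp t ht) fun a => a where
  dist _ _ := rfl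
  mass b := (Finset.sum_eq_single (M := ℝ) (ι := c.Supp) b (fun _ _ h => if_neg h)
    fun h => absurd (Finset.mem_univ _) h).trans (if_pos rfl)

theorem Coupling.realizes_left (c : Coupling X Y) : c.Realizes 0 X fun a => a.1.1 where
  dist a b := by simp [Coupling.interpDist]
  mass x := by
    have h := c.isPushforward_supp fun q => if q.1 = x then 1 else 0
    simp only [ite_mul, one_mul, zero_mul] at h
    rw [← h, ← c.margX x, Fintype.sum_prod_type_right]
    simp [Coupling.weight]

theorem Coupling.realizes_right (c : Coupling X Y) : c.Realizes 1 Y fun a => a.1.2 where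
  dist a b := by simp [Coupling.interpDist]
  mass y := by
    have h := c.isPushforward_supp fun q => if q.2 = y then 1 else 0
    simp only [ite_mul, one_mul, zero_mul] at h
    rw [← h, ← c.margY y, Fintype.sum_prod_type]
    simp [Coupling.weight]

theorem Coupling.Realizes.exists_hom (hp : 1 ≤ p) {c : Coupling X Y} {t : ℝ} {W : FMM}
    {φ : c.Supp → W.carrier} (h : c.Realizes t W φ) {s : ℝ} (hs : s ∈ Set.Ioo (0 : ℝ) 1)
    (hord : ∀ a b e f, c.interpDist s e f ≤ c.interpDist s a b →
      c.interpDist t e f ≤ c.interpDist t a b) :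
    ∃ f : MMHom (c.interp s hs) W, f.pcost p ≤ |t - s| * c.disP p := by
  refine ⟨⟨φ, fun a b e f hef => ?_, h.mass⟩, ?_⟩
  · exact (h.dist e f).trans_le ((hord a b e f hef).trans_eq (h.dist a b).symm)
  · rw [MMHom.pcost_eq_kernelNorm, c.disP_eq_kernelNorm,
      c.isPushforward_supp.kernelNorm_eq fun a => a.2.le]
    refine le_of_eq_of_le ?_
      (kernelNorm_const_mul_le hp (fun a : c.Supp => a.2.le) (t - s) _)
    change kernelNorm p (fun a : c.Supp => c.weight a.1)
      (fun a b => c.interpDist s a b - W.d (φ a) (φ b)) = _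
    congr 1
    funext a b
    rw [h.dist]
    simp only [Coupling.interpDist, metricDiff]
    ring

theorem Coupling.eventually_interpDist_le (c : Coupling X Y) (t : ℝ) :
    ∀ᶠ s in nhds t, ∀ a b e f, c.interpDist s e f ≤ c.interpDist s a b →
      c.interpDist t e f ≤ c.interpDist t a b := by
  simp only [Filter.eventually_all]
  intro a b e f
  by_cases h : c.interpDist t e f ≤ c.interpDist t a b
  · exact Filter.Eventually.of_forall fun _ _ => h
  · have hcont : ∀ a b, Continuous fun s => c.interpDist s a b := fun a b => by
      unfold Coupling.interpDist
      fun_prop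
    filter_upwards [(hcont a b).continuousAt.eventually_lt (hcont e f).continuousAt
      (not_le.1 h)] with s hs hle
    exact absurd hle (not_le.2 hs)

theorem propagate_zero_one {P : ℝ → Prop} (h0 : P 0)
    (hleft : ∀ t ∈ Set.Ioc (0 : ℝ) 1, ∀ᶠ s in nhdsWithin t (Set.Iio t), P s → P t)
    (hright : ∀ t ∈ Set.Ico (0 : ℝ) 1, ∀ᶠ s in nhdsWithin t (Set.Ioi t), P t → P s) :
    P 1 := by
  set S : Set ℝ := {t | t ∈ Set.Icc (0 : ℝ) 1 ∧ P t}
  have hbdd : BddAbove S := ⟨1, fun t ht => ht.1.2⟩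
  have hmem0 : (0 : ℝ) ∈ S := ⟨by simp, h0⟩
  have hlub := isLUB_csSup ⟨0, hmem0⟩ hbdd
  set u := sSup S
  have hu0 : 0 ≤ u := hlub.1 hmem0
  have hu1 : u ≤ 1 := hlub.2 fun t ht => ht.1.2
  have hPu : P u := by
    by_contra hPu
    have hpos : 0 < u := hu0.lt_of_ne fun h => hPu (h ▸ h0)
    obtain ⟨l, hl, hsub⟩ := mem_nhdsLT_iff_exists_Ioo_subset.1 (hleft u ⟨hpos, hu1⟩)
    obtain ⟨s, hs, hls, hsu⟩ := hlub.exists_between hl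
    exact hPu (hsub ⟨hls, hsu.lt_of_ne fun h => hPu (h ▸ hs.2)⟩ hs.2)
  rcases hu1.lt_or_eq with hlt | heq
  · obtain ⟨s, hs, hus, hs1⟩ := ((hright u ⟨hu0, hlt⟩).and
      (Ioo_mem_nhdsGT hlt)).exists
    exact absurd (hlub.1 ⟨⟨(hu0.trans_lt hus).le, hs1.le⟩, hs hPu⟩) (not_le.2 hus)
  · exact heq ▸ hPu

theorem Coupling.exists_path (hp : 1 ≤ p) (c : Coupling X Y) :
    ∃ q : MMPath X Y, mmPathCost p q ≤ c.disP p := by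
  suffices h : ∃ (W : FMM) (φ : c.Supp → W.carrier), c.Realizes 1 W φ ∧ ((1 : ℝ) = 1 → W = Y) ∧
      ∃ q : MMPath X W, mmPathCost p q ≤ 1 * c.disP p by
    obtain ⟨W, -, -, hW, q, hq⟩ := h
    obtain rfl := hW rfl
    exact ⟨q, by simpa using hq⟩
  refine propagate_zero_one (P := fun t => ∃ (W : FMM) (φ : c.Supp → W.carrier),
    c.Realizes t W φ ∧ (t = 1 → W = Y) ∧
      ∃ q : MMPath X W, mmPathCost p q ≤ t * c.disP p) ?_ ?_ ?_
  · exact ⟨X, _, c.realizes_left, by simp, .nil X, by simp [mmPathCost]⟩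
  · intro t ht
    filter_upwards [nhdsWithin_le_nhds (c.eventually_interpDist_le t),
      Ioo_mem_nhdsLT ht.1] with s hord hst
    rintro ⟨W, φ, hφ, -, q, hq⟩
    have hs : s ∈ Set.Ioo (0 : ℝ) 1 := ⟨hst.1, hst.2.trans_le ht.2⟩
    obtain ⟨V, ψ, hψ, hV⟩ : ∃ (V : FMM) (ψ : c.Supp → V.carrier),
        c.Realizes t V ψ ∧ (t = 1 → V = Y) := by
      rcases ht.2.lt_or_eq with hlt | rfl
      · exact ⟨_, _, c.realizes_interp ⟨ht.1, hlt⟩, fun h => absurd h hlt.ne⟩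
      · exact ⟨Y, _, c.realizes_right, fun _ => rfl⟩
    obtain ⟨f, hf⟩ := hφ.exists_hom hp hs fun _ _ _ _ h => h
    obtain ⟨g, hg⟩ := hψ.exists_hom hp hs hord
    refine ⟨V, ψ, hψ, hV, q.append (.bwd f (.fwd g (.nil V))), ?_⟩
    rw [abs_of_pos (sub_pos.2 hst.2)] at hg
    rw [sub_self, abs_zero, zero_mul] at hf
    rw [mmPathCost_append]
    simp only [mmPathCost]
    linarith
  · intro t ht
    filter_upwards [nhdsWithin_le_nhds (c.eventually_interpDist_le t),
      Ioo_mem_nhdsGT ht.2] with s hord hst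
    rintro ⟨W, φ, hφ, -, q, hq⟩
    have hs : s ∈ Set.Ioo (0 : ℝ) 1 := ⟨ht.1.trans_lt hst.1, hst.2⟩
    obtain ⟨f, hf⟩ := hφ.exists_hom hp hs hord
    refine ⟨_, _, c.realizes_interp hs, fun h => absurd h hst.2.ne,
      q.append (.bwd f (.nil _)), ?_⟩
    rw [abs_of_neg (sub_neg.2 hst.1)] at hf
    rw [mmPathCost_append]
    simp only [mmPathCost]
    linarith

end Interpolation

theorem editDistMM_eq_two_mul_dGW (p : ℝ≥0∞) (hp : 1 ≤ p) (X Y : FMM) :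
    editDistMM p X Y = 2 * dGW p X Y := by
  rw [dGW, ← mul_assoc, one_div, ENNReal.mul_inv_cancel (by simp) (by simp), one_mul]
  refine le_antisymm (le_iInf fun c => ?_) (le_iInf fun q => ?_)
  · obtain ⟨q, hq⟩ := c.exists_path hp
    exact (iInf_le _ q).trans (ENNReal.ofReal_le_ofReal hq)
  · obtain ⟨c, hc⟩ := q.exists_coupling hp
    exact (iInf_le _ c).trans (ENNReal.ofReal_le_ofReal hc)
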